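/- Let V be an OCA with state set Q, and let p, q be states. If p(0) →^π q(0) for a path π with |π| ≥ 2|Q|³, then there exist paths α, γ, η, a cycle β on some state r, and a cycle θ on some state s, such that π = α β γ θ η, β θ is nonempty, |β θ| ≤ 2|Q|³, and for every n ∈ ℕ, p(0) →^{α βⁿ γ θⁿ η} q(0). -/

import Mathlib

namespace TVASSpaper

/-- Actions of a one-counter automaton: `some a` with `a ∈ {-1,0,+1}` is an
    addition, `none` is the zero-test `tst`. -/
abbrev OAct := Option ℤ

abbrev OTrans (Q : Type) := Q × OAct × Q

/-- A one-counter automaton: a finite set of transitions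
    `Δ ⊆ Q × ({-1,0,+1} ∪ {tst}) × Q`. -/
structure OCA (Q : Type) where
  trans : Finset (OTrans Q)
  small : ∀ t ∈ trans, ∀ a : ℤ, t.2.1 = some a → a.natAbs ≤ 1

variable {Q : Type}

/-- The step induced by a single transition of an OCA. -/
def OStepBy (t : OTrans Q) (c c' : Q × ℕ) : Prop :=
  t.1 = c.1 ∧ t.2.2 = c'.1 ∧
    match t.2.1 with
    | some a => (c'.2 : ℤ) = (c.2 : ℤ) + a
    | none => c.2 = 0 ∧ c'.2 = 0

/-- `ORun V c π c'` : there is a run from `c` to `c'` taking the steps of the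
    word of transitions `π` in order. -/
inductive ORun (V : OCA Q) : Q × ℕ → List (OTrans Q) → Q × ℕ → Prop
  | nil (c : Q × ℕ) : ORun V c [] c
  | cons {t : OTrans Q} {c c' c'' : Q × ℕ} {π : List (OTrans Q)} :
      t ∈ V.trans → OStepBy t c c' → ORun V c' π c'' → ORun V c (t :: π) c''

/-- Reachability `c →* c'` in an OCA. -/
def OReach (V : OCA Q) (c c' : Q × ℕ) : Prop := ∃ π, ORun V c π c'

/-- `OIsPathFrom V p π q` : `π` is a path of `V` from state `p` to state `q`. -/
inductive OIsPathFrom (V : OCA Q) : Q → List (OTrans Q) → Q → Prop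
  | nil (p : Q) : OIsPathFrom V p [] p
  | cons {t : OTrans Q} {π : List (OTrans Q)} {q : Q} :
      t ∈ V.trans → OIsPathFrom V t.2.2 π q → OIsPathFrom V t.1 (t :: π) q

/-- `n`-fold concatenation of a word. -/
def pw {α : Type*} (l : List α) (n : ℕ) : List α := (List.replicate n l).flatten

/-- A weighted one-counter automaton: an OCA with a weight function on
    transitions. -/
structure WOCA (Q : Type) extends OCA Q where
  wt : OTrans Q → ℤ

/-- The weight of a path: the sum of the weights of its transitions. -/
def wlen (W : WOCA Q) (π : List (OTrans Q)) : ℤ := (π.map W.wt).sum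


theorem ORun.append {V : OCA Q} {c c' c'' : Q × ℕ} {π ρ : List (OTrans Q)}
    (h : ORun V c π c') (h' : ORun V c' ρ c'') : ORun V c (π ++ ρ) c'' := by
  induction h with
  | nil => exact h'
  | cons ht hs _ ih => exact ORun.cons ht hs (ih h')

theorem ORun.isPathFrom {V : OCA Q} {c c' : Q × ℕ} {π : List (OTrans Q)}
    (h : ORun V c π c') : OIsPathFrom V c.1 π c'.1 := by
  induction h with
  | nil c => exact OIsPathFrom.nil _
  | cons ht hs _ ih =>
    rw [← hs.1]
    exact OIsPathFrom.cons ht (hs.2.1 ▸ ih)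

theorem pw_succ {α : Type*} (l : List α) (n : ℕ) : pw l (n + 1) = l ++ pw l n := by
  simp [pw, List.replicate_succ]

theorem ORun.pw_up {V : OCA Q} {β : List (OTrans Q)} (n : ℕ) (f : ℕ → Q × ℕ)
    (h : ∀ m, ORun V (f m) β (f (m + 1))) : ORun V (f 0) (pw β n) (f n) := by
  induction n generalizing f with
  | zero => exact ORun.nil _
  | succ n ih =>
    rw [pw_succ]
    exact (h 0).append (ih (fun m => f (m + 1)) fun m => h (m + 1))

theorem ORun.pw_down {V : OCA Q} {β : List (OTrans Q)} (n : ℕ) (f : ℕ → Q × ℕ)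
    (h : ∀ m, ORun V (f (m + 1)) β (f m)) : ORun V (f n) (pw β n) (f 0) := by
  induction n with
  | zero => exact ORun.nil _
  | succ n ih =>
    rw [pw_succ]
    exact (h n).append ih

/-- A run listed as a sequence of transitions `τ` and a sequence of configurations `s`. -/
theorem ORun.exists_seq {V : OCA Q} {c c' : Q × ℕ} {π : List (OTrans Q)}
    (h : ORun V c π c') :
    ∃ (τ : ℕ → OTrans Q) (s : ℕ → Q × ℕ), s 0 = c ∧ s π.length = c' ∧
      π = (List.Ico 0 π.length).map τ ∧
      ∀ k < π.length, τ k ∈ V.trans ∧ OStepBy (τ k) (s k) (s (k + 1)) := by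
  induction h with
  | nil c => exact ⟨fun _ => (c.1, none, c.1), fun _ => c, rfl, rfl, by simp, by simp⟩
  | @cons t c c' c'' π ht hs _ ih =>
    obtain ⟨τ, s, h0, hL, hπ, hstep⟩ := ih
    refine ⟨fun k => Nat.casesOn k t τ, fun k => Nat.casesOn k c s, rfl, hL, ?_, ?_⟩
    · rw [List.Ico.zero_bot] at hπ ⊢
      rw [List.length_cons, List.range_succ_eq_map, List.map_cons, List.map_map]
      exact congrArg (t :: ·) hπ
    · rintro (_ | k) hk
      · exact ⟨ht, by simpa [h0] using hs⟩
      · exact hstep k (by simpa using hk)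

theorem ORun.of_seq {V : OCA Q} (τ : ℕ → OTrans Q) (s : ℕ → Q × ℕ) {a b : ℕ} (hab : a ≤ b)
    (h : ∀ k, a ≤ k → k < b → τ k ∈ V.trans ∧ OStepBy (τ k) (s k) (s (k + 1))) :
    ORun V (s a) ((List.Ico a b).map τ) (s b) := by
  induction b, hab using Nat.le_induction with
  | base => simpa using ORun.nil (s a)
  | succ b hab ih =>
    rw [List.Ico.succ_top hab, List.map_append]
    refine (ih fun k hk hk' => h k hk (by omega)).append ?_
    obtain ⟨ht, hs⟩ := h b hab (by omega)
    exact ORun.cons ht hs (ORun.nil _)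

/-- A step that touches a positive counter value is not a zero-test, so it can be shifted. -/
theorem OStepBy.shift {t : OTrans Q} {c c' : Q × ℕ} (h : OStepBy t c c')
    (hpos : 0 < c.2 ∨ 0 < c'.2) {x y : ℕ} (hxy : (y : ℤ) - x = (c'.2 : ℤ) - c.2) :
    OStepBy t (c.1, x) (c'.1, y) := by
  obtain ⟨h1, h2, h3⟩ := h
  refine ⟨h1, h2, ?_⟩
  rcases ht : t.2.1 with _ | a <;> simp only [ht] at h3 ⊢ <;> omega

theorem OStepBy.le_add_one {V : OCA Q} {t : OTrans Q} {c c' : Q × ℕ} (ht : t ∈ V.trans)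
    (h : OStepBy t c c') : c'.2 ≤ c.2 + 1 ∧ c.2 ≤ c'.2 + 1 := by
  obtain ⟨-, -, h3⟩ := h
  have hs := V.small t ht
  rcases ha : t.2.1 with _ | a
  · simp only [ha] at h3
    omega
  · simp only [ha] at h3
    have := hs a ha
    omega

/-- The last visit to level `i` before time `t`. -/
theorem exists_last_visit (f : ℕ → ℕ) (i t : ℕ) (h0 : f 0 ≤ i) (ht : i ≤ f t)
    (hf : ∀ k < t, f (k + 1) ≤ f k + 1) :
    ∃ u ≤ t, f u = i ∧ ∀ k, u < k → k ≤ t → i < f k := by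
  induction t with
  | zero => exact ⟨0, le_rfl, le_antisymm h0 ht, fun k hk hk' => by omega⟩
  | succ t ih =>
    rcases ht.eq_or_lt with h | h
    · exact ⟨t + 1, le_rfl, h.symm, fun k hk hk' => by omega⟩
    · have := hf t (by omega)
      obtain ⟨u, hu, hui, hk⟩ := ih (by omega) fun k hk => hf k (by omega)
      refine ⟨u, by omega, hui, fun k hk1 hk2 => ?_⟩
      rcases hk2.eq_or_lt with rfl | hlt
      · exact h
      · exact hk k hk1 (by omega)

/-- The first visit to level `i` after time `t`. -/
theorem exists_first_visit (f : ℕ → ℕ) (i t L : ℕ) (htL : t ≤ L) (hL : f L ≤ i) (ht : i ≤ f t)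
    (hf : ∀ k < L, f k ≤ f (k + 1) + 1) :
    ∃ d, t ≤ d ∧ d ≤ L ∧ f d = i ∧ ∀ k, t ≤ k → k < d → i < f k := by
  obtain ⟨u, hu, hui, hk⟩ := exists_last_visit (fun k => f (L - k)) i (L - t) (by simpa using hL)
    (by simpa [Nat.sub_sub_self htL] using ht) (fun k hk => by
      have := hf (L - (k + 1)) (by omega)
      rwa [show L - (k + 1) + 1 = L - k by omega] at this)
  refine ⟨L - u, by omega, by omega, hui, fun k hk1 hk2 => ?_⟩
  have := hk (L - k) (by omega) (by omega)
  rwa [Nat.sub_sub_self (by omega)] at this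

/-- A window of `|Q| ^ 3 + 1` configurations on `|Q| ^ 2` levels contains a repetition. -/
theorem exists_repetition [Fintype Q] (s : ℕ → Q × ℕ) (a lo : ℕ)
    (h : ∀ k, a ≤ k → k ≤ a + Fintype.card Q ^ 3 →
      lo ≤ (s k).2 ∧ (s k).2 < lo + Fintype.card Q ^ 2) :
    ∃ k l, a ≤ k ∧ k < l ∧ l ≤ a + Fintype.card Q ^ 3 ∧ s k = s l := by
  obtain ⟨k, hk, l, hl, hne, heq⟩ := Finset.exists_ne_map_eq_of_card_lt_of_maps_to
    (s := Finset.Icc a (a + Fintype.card Q ^ 3))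
    (t := (Finset.univ : Finset Q) ×ˢ Finset.Ico lo (lo + Fintype.card Q ^ 2)) (f := s)
    (by
      rw [Finset.card_product, Nat.card_Icc, Nat.card_Ico, Finset.card_univ,
        Nat.add_sub_cancel_left,
        show Fintype.card Q * Fintype.card Q ^ 2 = Fintype.card Q ^ 3 by ring]
      omega)
    (fun k hk => by
      have hk : k ∈ Finset.Icc a (a + Fintype.card Q ^ 3) := hk
      rw [Finset.mem_Icc] at hk
      have := h k hk.1 hk.2
      simpa using this)
  rw [Finset.mem_Icc] at hk hl
  rcases lt_or_gt_of_ne hne with hlt | hlt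
  · exact ⟨k, l, hk.1, hlt, hl.2, heq⟩
  · exact ⟨l, k, hl.1, hlt, hk.2, heq.symm⟩

/-- Lemma: one pair of short pumpable cycles in an OCA run. -/
theorem oca_pumping_pair (Q : Type) [Fintype Q] [Nonempty Q]
    (V : OCA Q) (p q : Q) (π : List (OTrans Q))
    (hrun : ORun V (p, 0) π (q, 0))
    (hlen : 2 * Fintype.card Q ^ 3 ≤ π.length) :
    ∃ α β γ θ η : List (OTrans Q),
      π = α ++ β ++ γ ++ θ ++ η ∧
      (∃ r, OIsPathFrom V r β r) ∧
      (∃ s, OIsPathFrom V s θ s) ∧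
      β ++ θ ≠ [] ∧
      β.length + θ.length ≤ 2 * Fintype.card Q ^ 3 ∧
      ∀ n : ℕ, ORun V (p, 0) (α ++ pw β n ++ γ ++ pw θ n ++ η) (q, 0) := by
  obtain ⟨τ, s, hs0, hsL, hπ, hstep⟩ := hrun.exists_seq
  have hwindow := exists_repetition s
  set L := π.length with hL
  set N := Fintype.card Q with hN
  have hN1 : 0 < N ^ 3 := pow_pos Fintype.card_pos 3
  have hseg : ∀ a b c, a ≤ b → b ≤ c → (List.Ico a c).map τ =
      (List.Ico a b).map τ ++ (List.Ico b c).map τ := fun a b c hab hbc => by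
    rw [← List.map_append, List.Ico.append_consecutive hab hbc]
  have hsub : ∀ a b, a ≤ b → b ≤ L → ORun V (s a) ((List.Ico a b).map τ) (s b) :=
    fun a b hab hb => ORun.of_seq τ s hab fun k _ hk => hstep k (by omega)
  by_cases hrep : ∃ k l, k < l ∧ l ≤ L ∧ l ≤ k + 2 * N ^ 3 ∧ s k = s l
  · obtain ⟨k, l, hkl, hlL, hlen', heq⟩ := hrep
    have hβ := hsub k l hkl.le hlL
    refine ⟨(List.Ico 0 k).map τ, (List.Ico k l).map τ, [], [], (List.Ico l L).map τ,
      ?_, ⟨(s k).1, ?_⟩, ⟨p, OIsPathFrom.nil p⟩, ?_, ?_, fun n => ?_⟩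
    · rw [List.append_nil, List.append_nil, ← hseg _ _ _ (Nat.zero_le k) hkl.le,
        ← hseg _ _ _ (Nat.zero_le l) hlL]
      exact hπ
    · have := hβ.isPathFrom
      rwa [← heq] at this
    · intro h
      have := congrArg List.length h
      simp at this
      omega
    · simp
      omega
    · have hp := ORun.pw_up n (fun _ => s k) fun _ => by
        rw [← heq] at hβ
        exact hβ
      have hα := hsub 0 k (Nat.zero_le k) (by omega)
      have hη := hsub l L hlL le_rfl
      rw [hs0] at hα
      rw [hsL, ← heq] at hη
      have hnil : pw ([] : List (OTrans Q)) n = [] := by simp [pw]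
      rw [hnil, List.append_nil, List.append_nil]
      exact (hα.append hp).append hη
  · obtain ⟨t, ht, hmax⟩ := Finset.exists_max_image (Finset.range (L + 1)) (fun k => (s k).2)
      ⟨0, by simp⟩
    simp only [Finset.mem_range, Nat.lt_succ_iff] at ht hmax
    set M := (s t).2 with hM
    have hMN : N ^ 2 ≤ M := by
      by_contra! hlt
      obtain ⟨k, l, -, hkl, hl, heq⟩ := hwindow 0 0 fun k _ hk =>
        ⟨Nat.zero_le _, by have := hmax k (by omega); omega⟩
      exact hrep ⟨k, l, hkl, by omega, by omega, heq⟩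
    have hup : ∀ i, ∃ u, i ≤ M → u ≤ t ∧ (s u).2 = i ∧ ∀ k, u < k → k ≤ t → i < (s k).2 := by
      intro i
      by_cases hi : i ≤ M
      · obtain ⟨u, hu⟩ := exists_last_visit (fun k => (s k).2) i t (by simp [hs0]) hi fun k hk =>
          (OStepBy.le_add_one (hstep k (by omega)).1 (hstep k (by omega)).2).1
        exact ⟨u, fun _ => hu⟩
      · exact ⟨0, fun h => absurd h hi⟩
    have hdown : ∀ i, ∃ d, i ≤ M →
        t ≤ d ∧ d ≤ L ∧ (s d).2 = i ∧ ∀ k, t ≤ k → k < d → i < (s k).2 := by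
      intro i
      by_cases hi : i ≤ M
      · obtain ⟨d, hd⟩ := exists_first_visit (fun k => (s k).2) i t L ht (by simp [hsL]) hi
          fun k hk => (OStepBy.le_add_one (hstep k hk).1 (hstep k hk).2).2
        exact ⟨d, fun _ => hd⟩
      · exact ⟨0, fun h => absurd h hi⟩
    choose u hu using hup
    choose d hd using hdown
    obtain ⟨i, j, hiM, hij, hjM, hcu, hcd⟩ : ∃ i j, M - N ^ 2 ≤ i ∧ i < j ∧ j ≤ M ∧
        (s (u i)).1 = (s (u j)).1 ∧ (s (d i)).1 = (s (d j)).1 := by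
      obtain ⟨i, hi, j, hj, hne, heq⟩ := Finset.exists_ne_map_eq_of_card_lt_of_maps_to
        (s := Finset.Icc (M - N ^ 2) M) (t := (Finset.univ : Finset (Q × Q)))
        (f := fun i => ((s (u i)).1, (s (d i)).1))
        (by
          rw [Finset.card_univ, Fintype.card_prod, Nat.card_Icc, ← hN, ← sq]
          omega)
        (fun _ _ => Finset.mem_coe.2 (Finset.mem_univ _))
      rw [Finset.mem_Icc] at hi hj
      obtain ⟨h1, h2⟩ := Prod.mk.inj heq
      rcases lt_or_gt_of_ne hne with hlt | hlt
      · exact ⟨i, j, hi.1, hlt, hj.2, h1, h2⟩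
      · exact ⟨j, i, hj.1, hlt, hi.2, h1.symm, h2.symm⟩
    obtain ⟨huit, hui, huik⟩ := hu i (by omega)
    obtain ⟨hujt, huj, hujk⟩ := hu j hjM
    obtain ⟨hdit, hdiL, hdi, hdik⟩ := hd i (by omega)
    obtain ⟨hdjt, hdjL, hdj, hdjk⟩ := hd j hjM
    have huu : u i < u j := by
      by_contra! hle
      rcases hle.eq_or_lt with h | h
      · rw [h] at huj
        omega
      · have := hujk _ h huit
        omega
    have hdd : d j < d i := by
      by_contra! hle
      rcases hle.eq_or_lt with h | h
      · rw [h] at hdi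
        omega
      · have := hdjk _ hdit h
        omega
    have hlevel : ∀ k, u i < k → k < d i → i < (s k).2 := fun k h1 h2 => by
      rcases le_total k t with h | h
      · exact huik k h1 h
      · exact hdik k h h2
    have hlevel' : ∀ k, u j ≤ k → k ≤ d j → j ≤ (s k).2 := fun k h1 h2 => by
      rcases h1.eq_or_lt with rfl | h1
      · exact huj.ge
      rcases h2.eq_or_lt with rfl | h2
      · exact hdj.ge
      rcases le_total k t with h | h
      · exact (hujk k h1 h).le
      · exact (hdjk k h h2).le
    have hspan : d i ≤ u i + 1 + N ^ 3 := by
      by_contra! hlt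
      obtain ⟨k, l, hk, hkl, hl, heq⟩ := hwindow (u i + 1) (i + 1) fun k hk1 hk2 =>
        ⟨hlevel k (by omega) (by omega), by have := hmax k (by omega); omega⟩
      exact hrep ⟨k, l, hkl, by omega, by omega, heq⟩
    have hshift : ∀ (e : ℕ → ℕ) (a b : ℕ), a ≤ b → b ≤ L →
        (∀ k, a ≤ k → k < b → 0 < (s k).2 ∨ 0 < (s (k + 1)).2) →
        (∀ k, a ≤ k → k < b → (e (k + 1) : ℤ) - e k = ((s (k + 1)).2 : ℤ) - (s k).2) →
        ORun V ((s a).1, e a) ((List.Ico a b).map τ) ((s b).1, e b) :=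
      fun e a b hab hb hpos hdiff => ORun.of_seq τ (fun k => ((s k).1, e k)) hab fun k hk hk' =>
        ⟨(hstep k (by omega)).1, (hstep k (by omega)).2.shift (hpos k hk hk') (hdiff k hk hk')⟩
    have hβ : ∀ m, ORun V ((s (u i)).1, i + m * (j - i)) ((List.Ico (u i) (u j)).map τ)
        ((s (u i)).1, i + (m + 1) * (j - i)) := fun m => by
      have := hshift (fun k => (s k).2 + m * (j - i)) (u i) (u j) huu.le (by omega)
        (fun k h1 h2 => Or.inr (by have := hlevel (k + 1) (by omega) (by omega); omega))
        (fun k _ _ => by push_cast; ring)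
      simp only [hui, huj, ← hcu] at this
      rwa [show j + m * (j - i) = i + (m + 1) * (j - i) by rw [add_one_mul]; omega] at this
    have hθ : ∀ m, ORun V ((s (d i)).1, i + (m + 1) * (j - i)) ((List.Ico (d j) (d i)).map τ)
        ((s (d i)).1, i + m * (j - i)) := fun m => by
      have := hshift (fun k => (s k).2 + m * (j - i)) (d j) (d i) hdd.le hdiL
        (fun k h1 h2 => Or.inl (by have := hlevel k (by omega) (by omega); omega))
        (fun k _ _ => by push_cast; ring)
      simp only [hdi, hdj, ← hcd] at this
      rwa [show j + m * (j - i) = i + (m + 1) * (j - i) by rw [add_one_mul]; omega] at this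
    have hγ : ∀ n, ORun V ((s (u i)).1, i + n * (j - i)) ((List.Ico (u j) (d j)).map τ)
        ((s (d i)).1, i + n * (j - i)) := fun n => by
      have := hshift (fun k => ((s k).2 - j) + (i + n * (j - i))) (u j) (d j) (by omega) hdjL
        (fun k h1 h2 => Or.inl (by have := hlevel' k h1 h2.le; omega))
        (fun k h1 h2 => by
          have := hlevel' k h1 h2.le
          have := hlevel' (k + 1) (by omega) (by omega)
          omega)
      simpa only [huj, hdj, ← hcu, ← hcd, Nat.sub_self, Nat.zero_add] using this
    refine ⟨(List.Ico 0 (u i)).map τ, (List.Ico (u i) (u j)).map τ, (List.Ico (u j) (d j)).map τ,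
      (List.Ico (d j) (d i)).map τ, (List.Ico (d i) L).map τ, ?_, ⟨_, (hβ 0).isPathFrom⟩,
      ⟨_, (hθ 0).isPathFrom⟩, ?_, ?_, fun n => ?_⟩
    · rw [← hseg _ _ _ (Nat.zero_le _) huu.le, ← hseg _ _ _ (Nat.zero_le _) (by omega),
        ← hseg _ _ _ (Nat.zero_le _) hdd.le, ← hseg _ _ _ (Nat.zero_le _) hdiL]
      exact hπ
    · intro h
      have := congrArg List.length h
      simp at this
      omega
    · simp only [List.length_map, List.Ico.length]
      omega
    · have hα := hsub 0 (u i) (Nat.zero_le _) (by omega)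
      have hη := hsub (d i) L hdiL le_rfl
      have hβn := ORun.pw_up n (fun m => ((s (u i)).1, i + m * (j - i))) hβ
      have hθn := ORun.pw_down n (fun m => ((s (d i)).1, i + m * (j - i))) hθ
      simp only [Nat.zero_mul, Nat.add_zero] at hβn hθn
      rw [hs0, show s (u i) = ((s (u i)).1, i) from Prod.ext rfl hui] at hα
      rw [hsL, show s (d i) = ((s (d i)).1, i) from Prod.ext rfl hdi] at hη
      exact (((hα.append hβn).append (hγ n)).append hθn).append hη

end TVASSpaper
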